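/- arXiv:2506.17780 — 2 statements merged into one kernel-verified Lean document; each statement's English description precedes it below -/
import Mathlib

section
/- Let n ≥ 1, s ∈ (0,1), α ≥ 0, β ≥ 0 with α + β > 0, R > 0 and M₁ > 0. Let f : ℝⁿ → ℝ be measurable and integrable with 0 ≤ f(z) ≤ M₁ for almost every z, and define g : ℝⁿ → ℝ by g(z) = M₁ if |z| ≤ R and g(z) = 0 otherwise. If ∫_{ℝⁿ} (α|z|² + β|z|^{2s}) f(z) dz ≤ ∫_{ℝⁿ} (α|z|² + β|z|^{2s}) g(z) dz < ∞, then ∫_{ℝⁿ} f(z) dz ≤ ∫_{ℝⁿ} g(z) dz = M₁ · (2π^{n/2}/Γ(n/2)) · Rⁿ/n. -/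
open MeasureTheory Real

/-- If `(w - c) * (f - g)` is almost everywhere nonnegative for some `c > 0`, then comparison of the
`w`-weighted integrals of `f` and `g` implies comparison of the integrals. -/
theorem integral_le_integral_of_weighted_le {X : Type*} [MeasurableSpace X] {μ : Measure X}
    {w f g : X → ℝ} {c : ℝ} (hc : 0 < c) (hf : Integrable f μ) (hg : Integrable g μ)
    (hwf : Integrable (fun x => w x * f x) μ) (hwg : Integrable (fun x => w x * g x) μ)
    (hsign : ∀ᵐ x ∂μ, 0 ≤ (w x - c) * (f x - g x))
    (hle : ∫ x, w x * f x ∂μ ≤ ∫ x, w x * g x ∂μ) :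
    ∫ x, f x ∂μ ≤ ∫ x, g x ∂μ := by
  have h : ∫ x, c * (f x - g x) ∂μ ≤ ∫ x, (w x * f x - w x * g x) ∂μ := by
    refine integral_mono_ae ((hf.sub hg).const_mul c) (hwf.sub hwg) ?_
    filter_upwards [hsign] with x hx
    linarith
  rw [integral_const_mul, integral_sub hf hg, integral_sub hwf hwg] at h
  nlinarith

/-- The volume of a closed Euclidean ball, in terms of the surface measure of the unit sphere. -/
theorem EuclideanSpace.volumeReal_closedBall_eq_sphere {n : ℕ} (hn : 1 ≤ n)
    (x : EuclideanSpace ℝ (Fin n)) {R : ℝ} (hR : 0 ≤ R) :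
    volume.real (Metric.closedBall x R) =
      2 * Real.pi ^ ((n : ℝ) / 2) / Real.Gamma ((n : ℝ) / 2) * R ^ (n : ℝ) / n := by
  have : Nonempty (Fin n) := ⟨⟨0, hn⟩⟩
  have hn' : (0 : ℝ) < n := by exact_mod_cast hn
  have hG : 0 < Real.Gamma ((n : ℝ) / 2) := Real.Gamma_pos_of_pos (by positivity)
  have hpi : √Real.pi ^ n = Real.pi ^ ((n : ℝ) / 2) := by
    rw [Real.sqrt_eq_rpow, ← Real.rpow_mul_natCast Real.pi_pos.le]
    congr 1
    ring
  rw [measureReal_def, EuclideanSpace.volume_closedBall, Fintype.card_fin,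
    Real.Gamma_add_one (by positivity), hpi, ENNReal.toReal_mul, ENNReal.toReal_pow,
    ENNReal.toReal_ofReal hR, ENNReal.toReal_ofReal (by positivity), Real.rpow_natCast]
  field_simp

theorem bathtub_integral_comparison
    (n : ℕ) (hn : 1 ≤ n) (s α β R M₁ : ℝ)
    (hs : s ∈ Set.Ioo (0 : ℝ) 1) (hα : 0 ≤ α) (hβ : 0 ≤ β) (hαβ : 0 < α + β)
    (hR : 0 < R) (hM₁ : 0 < M₁)
    (f : EuclideanSpace ℝ (Fin n) → ℝ) (hfm : Measurable f) (hfi : Integrable f)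
    (hbd : ∀ᵐ z ∂volume, 0 ≤ f z ∧ f z ≤ M₁)
    (g : EuclideanSpace ℝ (Fin n) → ℝ)
    (hg : ∀ z, g z = if ‖z‖ ≤ R then M₁ else 0)
    (hwf : Integrable (fun z => (α * ‖z‖ ^ (2 : ℝ) + β * ‖z‖ ^ (2 * s)) * f z))
    (hwg : Integrable (fun z => (α * ‖z‖ ^ (2 : ℝ) + β * ‖z‖ ^ (2 * s)) * g z))
    (hle : ∫ z, (α * ‖z‖ ^ (2 : ℝ) + β * ‖z‖ ^ (2 * s)) * f z ≤
        ∫ z, (α * ‖z‖ ^ (2 : ℝ) + β * ‖z‖ ^ (2 * s)) * g z) :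
    (∫ z, f z ≤ ∫ z, g z) ∧
      ∫ z, g z = M₁ * (2 * Real.pi ^ ((n : ℝ) / 2) / Real.Gamma ((n : ℝ) / 2)) *
        R ^ (n : ℝ) / n := by
  have hgi : g = (Metric.closedBall 0 R).indicator (fun _ => M₁) := by
    ext z
    rw [hg, Set.indicator]
    simp only [mem_closedBall_zero_iff]
  have hball : volume (Metric.closedBall (0 : EuclideanSpace ℝ (Fin n)) R) ≠ ⊤ :=
    measure_closedBall_lt_top.ne
  refine ⟨?_, ?_⟩
  · have hgint : Integrable g := by
      rw [hgi]
      exact (integrable_indicator_iff Metric.isClosed_closedBall.measurableSet).2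
        (integrableOn_const hball)
    have hmono : ∀ a b : ℝ, 0 ≤ a → a ≤ b →
        α * a ^ (2 : ℝ) + β * a ^ (2 * s) ≤ α * b ^ (2 : ℝ) + β * b ^ (2 * s) := by
      intro a b ha hab
      have := hs.1
      gcongr
    have hc : 0 < α * R ^ (2 : ℝ) + β * R ^ (2 * s) := by
      have h₁ := Real.rpow_pos_of_pos hR 2
      have h₂ := Real.rpow_pos_of_pos hR (2 * s)
      rcases hα.eq_or_lt with rfl | hα'
      · have : 0 < β := by simpa using hαβ
        positivity
      · positivity
    refine integral_le_integral_of_weighted_le hc hfi hgint hwf hwg ?_ hle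
    filter_upwards [hbd] with z hz
    rw [hg]
    split_ifs with h
    · exact mul_nonneg_of_nonpos_of_nonpos
        (sub_nonpos.2 (hmono _ _ (norm_nonneg z) h)) (sub_nonpos.2 hz.2)
    · exact mul_nonneg (sub_nonneg.2 (hmono _ _ hR.le (not_le.1 h).le)) (by simpa using hz.1)
  · rw [hgi, integral_indicator_const _ Metric.isClosed_closedBall.measurableSet,
      EuclideanSpace.volumeReal_closedBall_eq_sphere hn 0 hR.le, smul_eq_mul]
    ring
end

section
/- Let n ≥ 1 and s ∈ (0,1), and let c_{n,s} = ( ∫_{ℝⁿ} (1 − cos ζ₁)/|ζ|^{n+2s} dζ )^{-1}, where ζ₁ denotes the first coordinate of ζ ∈ ℝⁿ. Then for every smooth compactly supported function u : ℝⁿ → ℝ, with û(ξ) = (2π)^{-n/2} ∫_{ℝⁿ} e^{-i⟨x,ξ⟩} u(x) dx, one has ∫_{ℝⁿ} ∫_{ℝⁿ} |u(x) − u(y)|² / |x − y|^{n+2s} dx dy = (2 / c_{n,s}) ∫_{ℝⁿ} |ξ|^{2s} |û(ξ)|² dξ. -/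
open MeasureTheory Real RealInnerProductSpace

/-- The Fourier transform with the convention
`û(ξ) = (2π)^{-n/2} ∫ e^{-i⟨x,ξ⟩} u(x) dx`. -/
noncomputable def fourierT (n : ℕ) (u : EuclideanSpace ℝ (Fin n) → ℂ)
    (ξ : EuclideanSpace ℝ (Fin n)) : ℂ :=
  (((2 * Real.pi) ^ (-(n : ℝ) / 2) : ℝ) : ℂ) *
    ∫ x, Complex.exp (-Complex.I * (⟪x, ξ⟫ : ℝ)) * u x

theorem integrable_one_sub_cos_div_norm_rpow
    (n : ℕ) (hn : 1 ≤ n) (s : ℝ) (hs : s ∈ Set.Ioo (0 : ℝ) 1) :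
    Integrable (fun ζ : EuclideanSpace ℝ (Fin n) =>
      (1 - Real.cos (ζ ⟨0, hn⟩)) / ‖ζ‖ ^ ((n : ℝ) + 2 * s)) := by
  have : Nonempty (Fin n) := ⟨⟨0, hn⟩⟩
  set f : ℝ → ℝ := fun r => (if r ≤ 1 then r ^ 2 else 2) / r ^ ((n : ℝ) + 2 * s) with hf
  have hfi : Integrable (fun ζ : EuclideanSpace ℝ (Fin n) => f ‖ζ‖) := by
    rw [integrable_fun_norm_addHaar volume, finrank_euclideanSpace, Fintype.card_fin,
      ← Set.Ioc_union_Ioi_eq_Ioi zero_le_one]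
    have key : ∀ y : ℝ, 0 < y → y ^ (n - 1) / y ^ ((n : ℝ) + 2 * s) = y ^ (-1 - 2 * s) := by
      intro y hy
      rw [← Real.rpow_natCast, ← Real.rpow_sub hy, Nat.cast_sub hn]
      congr 1
      push_cast
      ring
    refine IntegrableOn.union ?_ ?_
    · have h : IntegrableOn (fun y : ℝ => y ^ (1 - 2 * s)) (Set.Ioc 0 1) := by
        rw [← intervalIntegrable_iff_integrableOn_Ioc_of_le zero_le_one]
        exact intervalIntegral.intervalIntegrable_rpow' (by linarith [hs.2])
      refine h.congr_fun (fun y hy => ?_) measurableSet_Ioc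
      have hy0 : 0 < y := hy.1
      simp only [hf, if_pos hy.2, smul_eq_mul]
      rw [mul_div_left_comm, key y hy0, ← Real.rpow_natCast, ← Real.rpow_add hy0]
      congr 1
      push_cast
      ring
    · have h : IntegrableOn (fun y : ℝ => 2 * y ^ (-1 - 2 * s)) (Set.Ioi 1) :=
        (integrableOn_Ioi_rpow_of_lt (by linarith [hs.1]) zero_lt_one).const_mul 2
      refine h.congr_fun (fun y hy => ?_) measurableSet_Ioi
      have hy0 : 0 < y := zero_lt_one.trans hy
      simp only [hf, if_neg (not_le.2 (Set.mem_Ioi.1 hy)), smul_eq_mul]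
      rw [mul_div_left_comm, key y hy0]
  refine hfi.mono' (Measurable.aestronglyMeasurable (by fun_prop)) (Filter.Eventually.of_forall fun ζ => ?_)
  have hpos : 0 ≤ ‖ζ‖ ^ ((n : ℝ) + 2 * s) := by positivity
  rw [Real.norm_of_nonneg (div_nonneg (by linarith [Real.cos_le_one (ζ ⟨0, hn⟩)]) hpos)]
  refine div_le_div_of_nonneg_right ?_ hpos
  split_ifs with h
  · have h1 := Real.one_sub_sq_div_two_le_cos (x := ζ ⟨0, hn⟩)
    have h2 : ‖ζ ⟨0, hn⟩‖ ≤ ‖ζ‖ := PiLp.norm_apply_le ζ _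
    have h3 : (ζ ⟨0, hn⟩) ^ 2 ≤ ‖ζ‖ ^ 2 := by
      rw [← sq_abs]
      exact pow_le_pow_left₀ (abs_nonneg _) h2 2
    nlinarith [sq_nonneg (ζ ⟨0, hn⟩)]
  · linarith [Real.neg_one_le_cos (ζ ⟨0, hn⟩)]

theorem integrable_and_integral_one_sub_cos_inner
    (n : ℕ) (hn : 1 ≤ n) (s : ℝ) (hs : s ∈ Set.Ioo (0 : ℝ) 1) (w : EuclideanSpace ℝ (Fin n)) :
    Integrable (fun z : EuclideanSpace ℝ (Fin n) =>
      (1 - Real.cos ⟪z, w⟫) / ‖z‖ ^ ((n : ℝ) + 2 * s)) ∧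
    ∫ z : EuclideanSpace ℝ (Fin n), (1 - Real.cos ⟪z, w⟫) / ‖z‖ ^ ((n : ℝ) + 2 * s) =
      ‖w‖ ^ (2 * s) * ∫ ζ : EuclideanSpace ℝ (Fin n),
        (1 - Real.cos (ζ ⟨0, hn⟩)) / ‖ζ‖ ^ ((n : ℝ) + 2 * s) := by
  rcases eq_or_ne w 0 with rfl | hw
  · simp [Real.zero_rpow (mul_pos two_pos hs.1).ne']
  have hw0 : 0 < ‖w‖ := norm_pos_iff.2 hw
  set w' : EuclideanSpace ℝ (Fin n) := EuclideanSpace.single ⟨0, hn⟩ ‖w‖ with hw'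
  have hnorm : ‖w'‖ = ‖w‖ := by simp [hw']
  set R := (Submodule.span ℝ {w' - w})ᗮ.reflection
  have hR : R w' = w := Submodule.reflection_sub hnorm
  set g : EuclideanSpace ℝ (Fin n) → ℝ := fun ζ =>
    (1 - Real.cos (ζ ⟨0, hn⟩)) / ‖ζ‖ ^ ((n : ℝ) + 2 * s) with hg
  set f : EuclideanSpace ℝ (Fin n) → ℝ := fun z =>
    (1 - Real.cos ⟪z, w⟫) / ‖z‖ ^ ((n : ℝ) + 2 * s) with hf
  have hgi : Integrable g := integrable_one_sub_cos_div_norm_rpow n hn s hs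
  have hfR : f ∘ R = fun ζ => ‖w‖ ^ ((n : ℝ) + 2 * s) * g (‖w‖ • ζ) := by
    ext ζ
    have h1 : ⟪R ζ, w⟫ = ‖w‖ * ζ ⟨0, hn⟩ := by
      conv_lhs => rw [← hR]
      rw [R.inner_map_map, hw', EuclideanSpace.inner_single_right]
      simp
    simp only [Function.comp_apply, hf, hg, h1, R.norm_map, norm_smul, norm_norm, PiLp.smul_apply,
      smul_eq_mul]
    rw [Real.mul_rpow hw0.le (norm_nonneg _), ← mul_div_assoc,
      mul_div_mul_left _ _ (Real.rpow_pos_of_pos hw0 _).ne']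
  have hmp : MeasurePreserving R := R.measurePreserving
  have hme : MeasurableEmbedding R := R.toHomeomorph.measurableEmbedding
  constructor
  · rw [← hmp.integrable_comp_emb hme, hfR]
    exact ((integrable_comp_smul_iff volume g hw0.ne').2 hgi).const_mul _
  · rw [← hmp.integral_comp hme]
    change ∫ ζ, (f ∘ R) ζ = _
    rw [hfR, integral_const_mul, Measure.integral_comp_smul_of_nonneg volume g ‖w‖ (hR := hw0.le),
      finrank_euclideanSpace, Fintype.card_fin, smul_eq_mul, ← mul_assoc, Real.rpow_add hw0,
      Real.rpow_natCast]
    congr 1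
    field_simp

open FourierTransform in
theorem fourier_sub_comp_add_right {n : ℕ} (f : EuclideanSpace ℝ (Fin n) → ℂ) (hf : Integrable f)
    (z η : EuclideanSpace ℝ (Fin n)) :
    ‖𝓕 (fun x => f x - f (x + z)) η‖ ^ 2 =
      2 * (1 - Real.cos (2 * π * ⟪z, η⟫)) * ‖𝓕 f η‖ ^ 2 := by
  have h1 : 𝓕 (fun x => f (x + z)) η = Real.fourierChar ⟪z, η⟫ • 𝓕 f η :=
    congrFun (VectorFourier.fourierIntegral_comp_add_right Real.fourierChar volume
      (innerₗ (EuclideanSpace ℝ (Fin n))) f z) η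
  have h2 : 𝓕 (fun x => f x - f (x + z)) η = 𝓕 f η - 𝓕 (fun x => f (x + z)) η := by
    simp only [Real.fourier_eq, smul_sub]
    exact integral_sub ((Real.fourierIntegral_convergent_iff η).2 hf)
      ((Real.fourierIntegral_convergent_iff η).2 (hf.comp_add_right z))
  rw [h2, h1, Circle.smul_def, Real.fourierChar_apply, smul_eq_mul, ← one_sub_mul, norm_mul, mul_pow]
  congr 1
  rw [← Complex.normSq_eq_norm_sq, Complex.normSq_apply, Complex.sub_re, Complex.sub_im,
    Complex.exp_ofReal_mul_I_re, Complex.exp_ofReal_mul_I_im, Complex.one_re, Complex.one_im]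
  nlinarith [Real.sin_sq_add_cos_sq (2 * π * ⟪z, η⟫)]

open FourierTransform in
theorem lintegral_sub_sq_eq_fourier {n : ℕ} (u : EuclideanSpace ℝ (Fin n) → ℝ)
    (hu : ContDiff ℝ (⊤ : ℕ∞) u) (hsupp : HasCompactSupport u) (z : EuclideanSpace ℝ (Fin n)) :
    ∫⁻ x, ENNReal.ofReal ((u x - u (x + z)) ^ 2) =
      ∫⁻ η, ENNReal.ofReal (2 * (1 - Real.cos (2 * π * ⟪z, η⟫)) *
        ‖𝓕 (fun x => (u x : ℂ)) η‖ ^ 2) := by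
  have hc : ContDiff ℝ (⊤ : ℕ∞) (fun x => ((u x : ℂ) - (u (x + z) : ℂ))) :=
    (Complex.ofRealCLM.contDiff.comp hu).sub
      (Complex.ofRealCLM.contDiff.comp (hu.comp (contDiff_id.add contDiff_const)))
  have hs1 : HasCompactSupport (fun x => (u x : ℂ)) := hsupp.comp_left (g := Complex.ofReal) rfl
  have hs2 : HasCompactSupport (fun x => (u (x + z) : ℂ)) :=
    hs1.comp_homeomorph (Homeomorph.addRight z)
  set g := (hs1.sub hs2).toSchwartzMap hc with hg
  have hui : Integrable (fun x => (u x : ℂ)) :=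
    (Complex.continuous_ofReal.comp hu.continuous).integrable_of_hasCompactSupport hs1
  have hP := SchwartzMap.integral_norm_sq_fourier g
  have hL : ∀ x, ‖g x‖ ^ 2 = (u x - u (x + z)) ^ 2 := by
    intro x
    change ‖((u x : ℂ) - (u (x + z) : ℂ))‖ ^ 2 = _
    rw [← Complex.ofReal_sub, Complex.norm_real, Real.norm_eq_abs, sq_abs]
  have hF : ∀ η, ‖𝓕 g η‖ ^ 2 = 2 * (1 - Real.cos (2 * π * ⟪z, η⟫)) *
        ‖𝓕 (fun x => (u x : ℂ)) η‖ ^ 2 := fun η =>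
    fourier_sub_comp_add_right (fun x => (u x : ℂ)) hui z η
  have hint : ∀ h : SchwartzMap (EuclideanSpace ℝ (Fin n)) ℂ, Integrable (fun x => ‖h x‖ ^ 2) :=
    fun h => (h.memLp 2 volume).norm.integrable_sq
  simp only [← hL, ← hF]
  rw [← ofReal_integral_eq_lintegral_ofReal (hint g) (by filter_upwards with x; positivity),
    ← ofReal_integral_eq_lintegral_ofReal (hint (𝓕 g)) (by filter_upwards with x; positivity), hP]

open FourierTransform in
theorem integral_norm_rpow_mul_fourierT (n : ℕ) (s : ℝ) (u : EuclideanSpace ℝ (Fin n) → ℂ) :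
    ∫ ξ, ‖ξ‖ ^ (2 * s) * ‖fourierT n u ξ‖ ^ 2 =
      ∫ η, ‖(2 * π) • η‖ ^ (2 * s) * ‖𝓕 u η‖ ^ 2 := by
  have h2 : 0 < 2 * π := by positivity
  have hT : ∀ ξ, ‖fourierT n u ξ‖ ^ 2 = ((2 * π) ^ n)⁻¹ * ‖𝓕 u ((2 * π)⁻¹ • ξ)‖ ^ 2 := by
    intro ξ
    have h : 𝓕 u ((2 * π)⁻¹ • ξ) = ∫ x, Complex.exp (-Complex.I * (⟪x, ξ⟫ : ℝ)) * u x := by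
      rw [Real.fourier_eq']
      refine integral_congr_ae (Filter.Eventually.of_forall fun x => ?_)
      simp only [smul_eq_mul, inner_smul_right]
      congr 2
      rw [show -2 * π * ((2 * π)⁻¹ * ⟪x, ξ⟫) = -⟪x, ξ⟫ by field_simp]
      push_cast
      ring
    rw [fourierT, h, norm_mul, mul_pow, Complex.norm_real, Real.norm_of_nonneg (by positivity),
      ← Real.rpow_mul_natCast h2.le]
    congr 1
    rw [show -(n : ℝ) / 2 * (2 : ℕ) = -(n : ℝ) by push_cast; ring, Real.rpow_neg h2.le,
      Real.rpow_natCast]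
  set f : EuclideanSpace ℝ (Fin n) → ℝ := fun η => ‖(2 * π) • η‖ ^ (2 * s) * ‖𝓕 u η‖ ^ 2 with hf
  have hfun : ∀ ξ, ‖ξ‖ ^ (2 * s) * ‖fourierT n u ξ‖ ^ 2 =
      ((2 * π) ^ n)⁻¹ * f ((2 * π)⁻¹ • ξ) := by
    intro ξ
    simp only [hf, hT, smul_inv_smul₀ h2.ne']
    ring
  simp only [hfun]
  rw [integral_const_mul,
    Measure.integral_comp_smul_of_nonneg volume f (2 * π)⁻¹ (hR := by positivity),
    finrank_euclideanSpace, Fintype.card_fin, smul_eq_mul, inv_pow, inv_inv,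
    inv_mul_cancel_left₀ (by positivity)]

open FourierTransform in
theorem lintegral_gagliardo_eq_fourier
    (n : ℕ) (hn : 1 ≤ n) (s : ℝ) (hs : s ∈ Set.Ioo (0 : ℝ) 1)
    (u : EuclideanSpace ℝ (Fin n) → ℝ)
    (hu : ContDiff ℝ (⊤ : ℕ∞) u) (hsupp : HasCompactSupport u) :
    ∫⁻ x, ∫⁻ y, ENNReal.ofReal ((u x - u y) ^ 2 / ‖x - y‖ ^ ((n : ℝ) + 2 * s)) =
      ∫⁻ η, ENNReal.ofReal (2 * (∫ ζ : EuclideanSpace ℝ (Fin n),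
          (1 - Real.cos (ζ ⟨0, hn⟩)) / ‖ζ‖ ^ ((n : ℝ) + 2 * s)) *
        (‖(2 * π) • η‖ ^ (2 * s) * ‖𝓕 (fun x => (u x : ℂ)) η‖ ^ 2)) := by
  have huc : Continuous u := hu.continuous
  have hui : Integrable (fun x => (u x : ℂ)) :=
    (Complex.continuous_ofReal.comp huc).integrable_of_hasCompactSupport
      (hsupp.comp_left (g := Complex.ofReal) rfl)
  have hFc : Continuous (𝓕 (fun x => (u x : ℂ))) :=
    VectorFourier.fourierIntegral_continuous Real.continuous_fourierChar
      (by exact continuous_inner) hui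
  set F := 𝓕 (fun x => (u x : ℂ))
  set p : ℝ := (n : ℝ) + 2 * s with hp
  have hnn : ∀ z : EuclideanSpace ℝ (Fin n), 0 ≤ (‖z‖ ^ p)⁻¹ := fun z => by positivity
  calc ∫⁻ x, ∫⁻ y, ENNReal.ofReal ((u x - u y) ^ 2 / ‖x - y‖ ^ p)
      = ∫⁻ x, ∫⁻ z, ENNReal.ofReal ((‖z‖ ^ p)⁻¹) * ENNReal.ofReal ((u x - u (x + z)) ^ 2) := by
        refine lintegral_congr fun x => ?_
        rw [← lintegral_add_left_eq_self _ x]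
        refine lintegral_congr fun z => ?_
        rw [← ENNReal.ofReal_mul (hnn z), sub_add_cancel_left, norm_neg, div_eq_inv_mul]
    _ = ∫⁻ z, ∫⁻ x, ENNReal.ofReal ((‖z‖ ^ p)⁻¹) * ENNReal.ofReal ((u x - u (x + z)) ^ 2) := by
        refine lintegral_lintegral_swap (Measurable.aemeasurable ?_)
        have := huc.measurable
        unfold Function.uncurry
        fun_prop
    _ = ∫⁻ z, ∫⁻ η, ENNReal.ofReal ((‖z‖ ^ p)⁻¹) *
          ENNReal.ofReal (2 * (1 - Real.cos (2 * π * ⟪z, η⟫)) * ‖F η‖ ^ 2) := by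
        refine lintegral_congr fun z => ?_
        rw [lintegral_const_mul' _ _ ENNReal.ofReal_ne_top,
          lintegral_const_mul' _ _ ENNReal.ofReal_ne_top, lintegral_sub_sq_eq_fourier u hu hsupp z]
    _ = ∫⁻ η, ∫⁻ z, ENNReal.ofReal ((‖z‖ ^ p)⁻¹) *
          ENNReal.ofReal (2 * (1 - Real.cos (2 * π * ⟪z, η⟫)) * ‖F η‖ ^ 2) := by
        refine lintegral_lintegral_swap (Measurable.aemeasurable ?_)
        have := hFc.measurable
        unfold Function.uncurry
        fun_prop
    _ = _ := by
        refine lintegral_congr fun η => ?_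
        obtain ⟨hi, hI⟩ :=
          integrable_and_integral_one_sub_cos_inner n hn s hs ((2 * π) • η)
        have h1 : ∀ z, ENNReal.ofReal ((‖z‖ ^ p)⁻¹) *
            ENNReal.ofReal (2 * (1 - Real.cos (2 * π * ⟪z, η⟫)) * ‖F η‖ ^ 2) =
            ENNReal.ofReal (2 * ‖F η‖ ^ 2) *
              ENNReal.ofReal ((1 - Real.cos ⟪z, (2 * π) • η⟫) / ‖z‖ ^ p) := by
          intro z
          rw [← ENNReal.ofReal_mul (hnn z), ← ENNReal.ofReal_mul (by positivity),
            inner_smul_right]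
          congr 1
          ring
        simp only [h1]
        rw [lintegral_const_mul' _ _ ENNReal.ofReal_ne_top,
          ← ofReal_integral_eq_lintegral_ofReal hi
            (Filter.Eventually.of_forall fun z => div_nonneg
              (sub_nonneg.2 (Real.cos_le_one _)) (by positivity)),
          ← ENNReal.ofReal_mul (by positivity), hI]
        congr 1
        ring

open FourierTransform in
theorem integrable_norm_rpow_mul_fourier_sq {n : ℕ} (s : ℝ) (hs : s ∈ Set.Ioo (0 : ℝ) 1)
    (u : EuclideanSpace ℝ (Fin n) → ℝ)
    (hu : ContDiff ℝ (⊤ : ℕ∞) u) (hsupp : HasCompactSupport u) :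
    Integrable (fun η => ‖(2 * π) • η‖ ^ (2 * s) * ‖𝓕 (fun x => (u x : ℂ)) η‖ ^ 2) := by
  set g := (hsupp.comp_left (g := Complex.ofReal) rfl).toSchwartzMap
    (Complex.ofRealCLM.contDiff.comp hu)
  change Integrable (fun η => ‖(2 * π) • η‖ ^ (2 * s) * ‖𝓕 g η‖ ^ 2)
  set G := 𝓕 g
  obtain ⟨C, hC⟩ := G.toBoundedContinuousFunction.bddAbove_range_norm_comp
  have hC' : ∀ η, ‖G η‖ ≤ C := fun η => hC ⟨η, rfl⟩
  have hGc : Continuous G := G.continuous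
  have hi : Integrable (fun η => C * (‖η‖ ^ 0 * ‖G η‖) +
      (2 * π) ^ 2 * C * (‖η‖ ^ 2 * ‖G η‖)) :=
    ((G.integrable_pow_mul volume 0).const_mul _).add ((G.integrable_pow_mul volume 2).const_mul _)
  refine hi.mono' (Measurable.aestronglyMeasurable ?_) (Filter.Eventually.of_forall fun η => ?_)
  · have := hGc.measurable
    fun_prop
  · rw [Real.norm_of_nonneg (by positivity), norm_smul,
      Real.norm_of_nonneg (by positivity : 0 ≤ 2 * π)]
    have ht : 0 ≤ 2 * π * ‖η‖ := by positivity
    have h1 : (2 * π * ‖η‖) ^ (2 * s) ≤ 1 + (2 * π * ‖η‖) ^ 2 := by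
      rcases le_total (2 * π * ‖η‖) 1 with h | h
      · linarith [Real.rpow_le_one ht h (by linarith [hs.1] : 0 ≤ 2 * s),
          sq_nonneg (2 * π * ‖η‖)]
      · have := Real.rpow_le_rpow_of_exponent_le h (by push_cast; linarith [hs.2] : 2 * s ≤ (2 : ℕ))
        rw [Real.rpow_natCast] at this
        linarith
    calc (2 * π * ‖η‖) ^ (2 * s) * ‖G η‖ ^ 2
        ≤ (1 + (2 * π * ‖η‖) ^ 2) * (C * ‖G η‖) := by
          rw [sq ‖G η‖]
          gcongr
          exact hC' η
      _ = _ := by ring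

/-- Fourier representation of the Gagliardo seminorm: the normalizing constant
`c_{n,s}` of the fractional Laplacian relates the Gagliardo seminorm to
`∫ |ξ|^{2s} |û(ξ)|² dξ`. -/
theorem gagliardo_eq_fourier
    (n : ℕ) (hn : 1 ≤ n) (s : ℝ) (hs : s ∈ Set.Ioo (0 : ℝ) 1) (c : ℝ)
    (hc : c = (∫ ζ : EuclideanSpace ℝ (Fin n),
        (1 - Real.cos (ζ ⟨0, hn⟩)) / ‖ζ‖ ^ ((n : ℝ) + 2 * s))⁻¹)
    (u : EuclideanSpace ℝ (Fin n) → ℝ)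
    (hu : ContDiff ℝ (⊤ : ℕ∞) u) (hsupp : HasCompactSupport u) :
    ∫ x, ∫ y, (u x - u y) ^ 2 / ‖x - y‖ ^ ((n : ℝ) + 2 * s) =
      (2 / c) * ∫ ξ, ‖ξ‖ ^ (2 * s) * ‖fourierT n (fun x => (u x : ℂ)) ξ‖ ^ 2 := by
  have hA := integrable_norm_rpow_mul_fourier_sq s hs u hu hsupp
  have hL := lintegral_gagliardo_eq_fourier n hn s hs u hu hsupp
  have hK : 0 ≤ ∫ ζ : EuclideanSpace ℝ (Fin n),
      (1 - Real.cos (ζ ⟨0, hn⟩)) / ‖ζ‖ ^ ((n : ℝ) + 2 * s) :=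
    integral_nonneg fun ζ => div_nonneg (sub_nonneg.2 (Real.cos_le_one _)) (by positivity)
  rw [hc, div_inv_eq_mul, integral_norm_rpow_mul_fourierT, ← integral_const_mul]
  set K := ∫ ζ : EuclideanSpace ℝ (Fin n),
      (1 - Real.cos (ζ ⟨0, hn⟩)) / ‖ζ‖ ^ ((n : ℝ) + 2 * s)
  rw [← ofReal_integral_eq_lintegral_ofReal (hA.const_mul _)
    (Filter.Eventually.of_forall fun η => by positivity)] at hL
  have hum : Measurable u := hu.continuous.measurable
  have hm : Measurable (fun x => ∫⁻ y, ENNReal.ofReal ((u x - u y) ^ 2 /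
      ‖x - y‖ ^ ((n : ℝ) + 2 * s))) := by
    refine Measurable.lintegral_prod_right' (f := fun q : _ × _ =>
      ENNReal.ofReal ((u q.1 - u q.2) ^ 2 / ‖q.1 - q.2‖ ^ ((n : ℝ) + 2 * s))) ?_
    fun_prop
  have hin : ∀ x, ∫ y, (u x - u y) ^ 2 / ‖x - y‖ ^ ((n : ℝ) + 2 * s) =
      (∫⁻ y, ENNReal.ofReal ((u x - u y) ^ 2 / ‖x - y‖ ^ ((n : ℝ) + 2 * s))).toReal := fun x =>
    integral_eq_lintegral_of_nonneg_ae (Filter.Eventually.of_forall fun y => by positivity)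
      (Measurable.aestronglyMeasurable (by fun_prop))
  simp only [hin]
  rw [integral_toReal hm.aemeasurable (ae_lt_top hm (hL ▸ ENNReal.ofReal_ne_top)), hL,
    ENNReal.toReal_ofReal (integral_nonneg fun η => by positivity)]
end
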